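/- arXiv:2512.16598 — 4 statements merged into one kernel-verified Lean document; each statement's English description precedes it below -/
import Mathlib

section
/- Consider the Muon-MVR iterates: M^0 = ∇f_{ξ^0}(X^0); for k ≥ 0, Y^{k+1} = argmin over {X : ‖X − X^k‖ ≤ η} of ⟨M^k, X − X^k⟩, X^{k+1} = (1−β)Y^{k+1}, and M^{k+1} = (1−α)(M^k − ∇f_{ξ^{k+1}}(X^k)) + ∇f_{ξ^{k+1}}(X^{k+1}), where ξ^0, ξ^1, … are i.i.d. samples from D. Assume f is star-convex with respect to a minimizer X^⋆, the gradient of f is L-Lipschitz with respect to ‖·‖ in the dual norm (i.e. ‖∇f(X) − ∇f(Y)‖_⋆ ≤ L‖X − Y‖ for all X, Y), and η ≥ β·max{‖X^0‖, ‖X^⋆‖}. Then for every k ≥ 0 the (pathwise) descent inequality holds: f(X^{k+1}) ≤ (1−β)f(X^k) + βf(X^⋆) + 4η²L + 2η‖M^k − ∇f(X^k)‖_⋆. -/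
open MeasureTheory RealInnerProductSpace

lemma aux_bdd {E : Type*} [NormedAddCommGroup E] [InnerProductSpace ℝ E] [FiniteDimensional ℝ E]
    (nrm : E → ℝ)
    (hnrm_smul : ∀ (c : ℝ) (x : E), nrm (c • x) = |c| * nrm x)
    (hnrm_add : ∀ x y : E, nrm (x + y) ≤ nrm x + nrm y)
    (hnrm_zero : ∀ x : E, nrm x = 0 ↔ x = 0) :
    ∃ C : ℝ, 0 ≤ C ∧ ∀ x, ‖x‖ ≤ C * nrm x := by
  let p : Seminorm ℝ E := Seminorm.of nrm hnrm_add (fun c x => by rw [hnrm_smul, Real.norm_eq_abs])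
  have hp0 : ∀ x, 0 ≤ nrm x := fun x => apply_nonneg p x
  have hc : Continuous nrm := by
    have hconv : ConvexOn ℝ Set.univ nrm := p.convexOn
    have := hconv.continuousOn isOpen_univ
    exact continuousOn_univ.mp this
  rcases subsingleton_or_nontrivial E with hE | hE
  · exact ⟨0, le_rfl, fun x => by rw [Subsingleton.elim x 0]; simp⟩
  obtain ⟨y, hy, hmin⟩ := (isCompact_sphere (0 : E) 1).exists_isMinOn
    (NormedSpace.sphere_nonempty.mpr zero_le_one) hc.continuousOn
  have hy0 : y ≠ 0 := by
    rintro rfl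
    simp at hy
  have hpos : 0 < nrm y := lt_of_le_of_ne (hp0 y) (fun h => hy0 ((hnrm_zero y).mp h.symm))
  refine ⟨(nrm y)⁻¹, by positivity, fun x => ?_⟩
  by_cases hx : x = 0
  · subst hx; simp [(hnrm_zero 0).mpr rfl]
  have hxn : 0 < ‖x‖ := norm_pos_iff.mpr hx
  have h1 : nrm y ≤ nrm (‖x‖⁻¹ • x) := hmin (by
    simp [norm_smul, hxn.ne'])
  rw [hnrm_smul, abs_of_pos (inv_pos.mpr hxn)] at h1
  rw [inv_mul_eq_div, le_div_iff₀ hpos]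
  rw [inv_mul_eq_div, le_div_iff₀ hxn] at h1
  linarith

lemma aux_holder {E : Type*} [NormedAddCommGroup E] [InnerProductSpace ℝ E] [FiniteDimensional ℝ E]
    (nrm dnrm : E → ℝ)
    (hnrm_smul : ∀ (c : ℝ) (x : E), nrm (c • x) = |c| * nrm x)
    (hnrm_add : ∀ x y : E, nrm (x + y) ≤ nrm x + nrm y)
    (hnrm_zero : ∀ x : E, nrm x = 0 ↔ x = 0)
    (hdual : ∀ x : E, dnrm x = sSup {r : ℝ | ∃ y : E, nrm y ≤ 1 ∧ r = ⟪x, y⟫}) :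
    (∀ x, 0 ≤ nrm x) ∧ (∀ u, 0 ≤ dnrm u) ∧ ∀ u v : E, ⟪u, v⟫ ≤ dnrm u * nrm v := by
  obtain ⟨C, hC, hb⟩ := aux_bdd nrm hnrm_smul hnrm_add hnrm_zero
  let p : Seminorm ℝ E := Seminorm.of nrm hnrm_add (fun c x => by rw [hnrm_smul, Real.norm_eq_abs])
  have hp0 : ∀ x, 0 ≤ nrm x := fun x => apply_nonneg p x
  have key : ∀ u v : E, nrm v ≤ 1 → ⟪u, v⟫ ≤ dnrm u := by
    intro u v hv
    rw [hdual]
    refine le_csSup ⟨‖u‖ * C, ?_⟩ ⟨v, hv, rfl⟩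
    rintro r ⟨y, hy, rfl⟩
    refine (real_inner_le_norm u y).trans ?_
    have : ‖y‖ ≤ C := (hb y).trans (by nlinarith)
    gcongr
  refine ⟨hp0, fun u => ?_, fun u v => ?_⟩
  · have := key u 0 (by rw [(hnrm_zero 0).mpr rfl]; norm_num)
    simpa using this
  · by_cases hv : v = 0
    · subst hv; simp [(hnrm_zero 0).mpr rfl]
    have hpos : 0 < nrm v := lt_of_le_of_ne (hp0 v) (fun h => hv ((hnrm_zero v).mp h.symm))
    have := key u ((nrm v)⁻¹ • v) (by
      rw [hnrm_smul, abs_of_pos (inv_pos.mpr hpos), inv_mul_cancel₀ hpos.ne'])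
    rw [real_inner_smul_right, inv_mul_eq_div, div_le_iff₀ hpos] at this
    exact this

lemma aux_deriv {E : Type*} [NormedAddCommGroup E] [InnerProductSpace ℝ E] [FiniteDimensional ℝ E]
    (f : E → ℝ) (gradF : E → E) (hf_grad : ∀ x, HasGradientAt f (gradF x) x) (x d : E) (t : ℝ) :
    HasDerivAt (fun t : ℝ => f (x + t • d)) ⟪gradF (x + t • d), d⟫ t := by
  have h1 : HasDerivAt (fun t : ℝ => x + t • d) d t := by
    simpa using ((hasDerivAt_id t).smul_const d).const_add x
  have h2 := (hf_grad (x + t • d)).hasFDerivAt.comp_hasDerivAt t h1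
  simp at h2
  exact h2

lemma aux_descent {E : Type*} [NormedAddCommGroup E] [InnerProductSpace ℝ E]
    [FiniteDimensional ℝ E]
    (f : E → ℝ) (gradF : E → E) (hf_grad : ∀ x, HasGradientAt f (gradF x) x)
    (x d : E) (K : ℝ)
    (h : ∀ t : ℝ, 0 < t → ⟪gradF (x + t • d) - gradF x, d⟫ ≤ t * K) :
    f (x + d) ≤ f x + ⟪gradF x, d⟫ + K / 2 := by
  have hd : ∀ t : ℝ, HasDerivAt (fun t : ℝ => f (x + t • d) - t * ⟪gradF x, d⟫ - t ^ 2 * (K / 2))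
      (⟪gradF (x + t • d), d⟫ - ⟪gradF x, d⟫ - t * K) t := by
    intro t
    have h1 := aux_deriv f gradF hf_grad x d t
    have h2 := (hasDerivAt_id t).mul_const ⟪gradF x, d⟫
    have h3 := (hasDerivAt_pow 2 t).mul_const (K / 2)
    refine ((h1.sub h2).sub h3).congr_deriv ?_
    simp; ring
  have hanti : AntitoneOn (fun t : ℝ => f (x + t • d) - t * ⟪gradF x, d⟫ - t ^ 2 * (K / 2))
      (Set.Icc 0 1) := by
    refine antitoneOn_of_deriv_nonpos (convex_Icc 0 1)
      (fun t _ => (hd t).continuousAt.continuousWithinAt)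
      (fun t _ => (hd t).differentiableAt.differentiableWithinAt) ?_
    intro t ht
    rw [interior_Icc] at ht
    rw [(hd t).deriv]
    have := h t ht.1
    rw [inner_sub_left] at this
    linarith
  have := hanti (Set.left_mem_Icc.mpr zero_le_one) (Set.right_mem_Icc.mpr zero_le_one) zero_le_one
  simp at this
  linarith

lemma aux_star {E : Type*} [NormedAddCommGroup E] [InnerProductSpace ℝ E]
    [FiniteDimensional ℝ E]
    (f : E → ℝ) (gradF : E → E) (hf_grad : ∀ x, HasGradientAt f (gradF x) x)
    (x xstar : E) 
    (hstar : ∀ (x : E) (b : ℝ), 0 ≤ b → b ≤ 1 →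
      f (b • xstar + (1 - b) • x) ≤ b * f xstar + (1 - b) * f x) :
    ⟪gradF x, xstar - x⟫ ≤ f xstar - f x := by
  have h1 := aux_deriv f gradF hf_grad x (xstar - x) 0
  have h2 := h1.tendsto_slope_zero_right
  rw [zero_smul, add_zero] at h2
  refine le_of_tendsto h2 ?_
  filter_upwards [Ioo_mem_nhdsGT (zero_lt_one : (0:ℝ) < 1)] with t ht
  have h3 := hstar x t ht.1.le ht.2.le
  have h4 : t • xstar + (1 - t) • x = x + t • (xstar - x) := by module
  rw [h4] at h3
  simp only [zero_add, smul_eq_mul]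
  rw [inv_mul_eq_div, div_le_iff₀ ht.1]
  linarith

/-- **Muon-MVR pathwise descent inequality** (star-convex case): along any sample path,
`f(X^{k+1}) ≤ (1−β)f(X^k) + βf(X^⋆) + 4η²L + 2η‖M^k − ∇f(X^k)‖_⋆`. -/
theorem muon_mvr_descent_inequality
    -- the ambient finite-dimensional real inner product space
    {E : Type*} [NormedAddCommGroup E] [InnerProductSpace ℝ E] [FiniteDimensional ℝ E]
    -- the data distribution
    {Ξ : Type*} [MeasurableSpace Ξ]
    (μ : Measure Ξ) [IsProbabilityMeasure μ]
    -- the objective `f = E_{ξ∼D}[f_ξ]`, the stochastic gradients `G ξ = ∇f_ξ`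
    -- (each `f_ξ` continuously differentiable) and the gradient `gradF = ∇f`
    (f : E → ℝ) (fs : Ξ → E → ℝ) (G : Ξ → E → E) (gradF : E → E)
    (hfs_grad : ∀ s x, HasGradientAt (fs s) (G s x) x)
    (hfs_cont : ∀ s, Continuous (G s))
    (hf_def : ∀ x, f x = ∫ s, fs s x ∂μ)
    (hf_bdd : BddBelow (Set.range f))
    (hf_grad : ∀ x, HasGradientAt f (gradF x) x)
    -- the non-Euclidean norm `nrm = ‖·‖` and its dual norm `dnrm = ‖·‖_⋆`
    (nrm dnrm : E → ℝ)
    (hnrm_smul : ∀ (c : ℝ) (x : E), nrm (c • x) = |c| * nrm x)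
    (hnrm_add : ∀ x y : E, nrm (x + y) ≤ nrm x + nrm y)
    (hnrm_zero : ∀ x : E, nrm x = 0 ↔ x = 0)
    (hdual : ∀ x : E, dnrm x = sSup {r : ℝ | ∃ y : E, nrm y ≤ 1 ∧ r = ⟪x, y⟫})
    -- parameters
    (L η α β : ℝ)
    (hL : 0 < L) (hη : 0 < η)
    (hα : α ∈ Set.Ioo (0 : ℝ) 1) (hβ : β ∈ Set.Ioo (0 : ℝ) 1)
    -- `X^⋆` is a minimizer of `f`, `f` is star-convex w.r.t. `X^⋆`, and `∇f` is
    -- `L`-Lipschitz with respect to `‖·‖` in the dual norm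
    (xstar : E) (hxstar : ∀ x, f xstar ≤ f x)
    (hstar : ∀ (x : E) (b : ℝ), 0 ≤ b → b ≤ 1 →
      f (b • xstar + (1 - b) • x) ≤ b * f xstar + (1 - b) * f x)
    (hlip : ∀ x y : E, dnrm (gradF x - gradF y) ≤ L * nrm (x - y))
    -- the trust-region radius condition
    (x0 : E) (hη_ge : η ≥ β * max (nrm x0) (nrm xstar))
    -- a sample path and the corresponding Muon-MVR iterates
    (ξ : ℕ → Ξ)
    (X Y M : ℕ → E)
    (hX0 : X 0 = x0)
    (hM0 : M 0 = G (ξ 0) (X 0))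
    (hY : ∀ k, nrm (Y (k + 1) - X k) ≤ η ∧
      ∀ z : E, nrm (z - X k) ≤ η →
        ⟪M k, Y (k + 1) - X k⟫ ≤ ⟪M k, z - X k⟫)
    (hX : ∀ k, X (k + 1) = (1 - β) • Y (k + 1))
    (hM : ∀ k, M (k + 1) =
      (1 - α) • (M k - G (ξ (k + 1)) (X k)) + G (ξ (k + 1)) (X (k + 1))) :
    ∀ k : ℕ, f (X (k + 1)) ≤
      (1 - β) * f (X k) + β * f xstar + 4 * η ^ 2 * L + 2 * η * dnrm (M k - gradF (X k)) := by
  obtain ⟨hn0, hd0, hold⟩ := aux_holder nrm dnrm hnrm_smul hnrm_add hnrm_zero hdual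
  obtain ⟨hβ0, hβ1⟩ := hβ
  have hneg : ∀ x, nrm (-x) = nrm x := fun x => by
    have := hnrm_smul (-1) x
    simpa using this
  have hsub : ∀ x y, nrm (x - y) ≤ nrm x + nrm y := fun x y => by
    have := hnrm_add x (-y)
    rwa [hneg, ← sub_eq_add_neg] at this
  have hxs : β * nrm xstar ≤ η := le_trans (by gcongr; exact le_max_right _ _) hη_ge
  have hbd : ∀ k, β * nrm (X k) ≤ η := by
    intro k
    induction k with
    | zero => rw [hX0]; exact le_trans (by gcongr; exact le_max_left _ _) hη_ge
    | succ k ih =>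
      rw [hX, hnrm_smul, abs_of_pos (by linarith)]
      have h1 : nrm (Y (k + 1)) ≤ nrm (Y (k + 1) - X k) + nrm (X k) := by
        simpa using hnrm_add (Y (k + 1) - X k) (X k)
      have h2 : nrm (Y (k + 1)) ≤ η + nrm (X k) := by linarith [(hY k).1]
      have h3 : β * nrm (Y (k + 1)) ≤ β * η + η := by nlinarith
      have h4 : (1 - β) * (β * nrm (Y (k + 1))) ≤ (1 - β) * (β * η + η) :=
        mul_le_mul_of_nonneg_left h3 (by linarith)
      nlinarith [mul_pos (mul_pos hβ0 hβ0) hη]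
  intro k
  have hgs : gradF xstar = 0 := by
    have hmin : IsLocalMin f xstar := Filter.Eventually.of_forall hxstar
    have h := hmin.hasFDerivAt_eq_zero (hf_grad xstar).hasFDerivAt
    simpa using h
  obtain ⟨hY1, hY2⟩ := hY k
  have hXk := hbd k
  set x := X k with hx
  set g := gradF x with hg
  set w := Y (k + 1) - x with hw
  have hXn : X (k + 1) = x + ((1 - β) • w - β • x) := by rw [hX, hw]; module
  clear_value w
  have hdn : nrm ((1 - β) • w - β • x) ≤ 2 * η := by
    refine (hsub _ _).trans ?_
    rw [hnrm_smul, hnrm_smul, abs_of_pos hβ0, abs_of_pos (by linarith : 0 < 1 - β)]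
    nlinarith
  have hdesc := aux_descent f gradF hf_grad x ((1 - β) • w - β • x) (L * (2 * η) ^ 2) (by
    intro t ht
    refine (hold _ _).trans ?_
    have h1 := hlip (x + t • ((1 - β) • w - β • x)) x
    rw [add_sub_cancel_left, hnrm_smul, abs_of_pos ht] at h1
    have h2 := hn0 ((1 - β) • w - β • x)
    calc _ ≤ (L * (t * nrm ((1 - β) • w - β • x))) * nrm ((1 - β) • w - β • x) := by gcongr
      _ ≤ (L * (t * (2 * η))) * (2 * η) := by gcongr
      _ = _ := by ring)
  rw [← hXn, ← hg, inner_sub_right, real_inner_smul_right, real_inner_smul_right] at hdesc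
  have hst := aux_star f gradF hf_grad x xstar hstar
  rw [← hg, inner_sub_right] at hst
  have hopt := hY2 (x + β • xstar) (by
    rw [add_sub_cancel_left, hnrm_smul, abs_of_pos hβ0]; exact hxs)
  rw [add_sub_cancel_left] at hopt
  have hD := hd0 (M k - g)
  have herr : ⟪M k - g, β • xstar - w⟫ ≤ dnrm (M k - g) * (2 * η) := by
    refine (hold _ _).trans ?_
    gcongr
    refine (hsub _ _).trans ?_
    rw [hnrm_smul, abs_of_pos hβ0]
    linarith
  rw [inner_sub_left, inner_sub_right, inner_sub_right] at herr
  rw [real_inner_smul_right] at herr hopt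
  rw [real_inner_smul_right] at herr
  have hgw : ⟪g, w⟫ ≤ β * ⟪g, xstar⟫ + dnrm (M k - g) * (2 * η) := by linarith
  have hgn : β * dnrm g ≤ 2 * η * L := by
    have h1 := hlip x xstar
    rw [hgs, sub_zero] at h1
    have h2 := hsub x xstar
    have h3 : β * nrm (x - xstar) ≤ 2 * η := by nlinarith
    nlinarith
  have hgap : - (β * (β * ⟪g, xstar⟫)) ≤ 2 * η ^ 2 * L := by
    have h1 := hold g (-xstar)
    rw [inner_neg_right, hneg] at h1
    have h2 := hd0 g
    have h3 := hn0 xstar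
    calc - (β * (β * ⟪g, xstar⟫)) = β * β * (-⟪g, xstar⟫) := by ring
      _ ≤ β * β * (dnrm g * nrm xstar) := by gcongr
      _ = (β * dnrm g) * (β * nrm xstar) := by ring
      _ ≤ (2 * η * L) * η := by gcongr
      _ = _ := by ring
  have h5 := mul_le_mul_of_nonneg_left hgw (by linarith : 0 ≤ 1 - β)
  have h6 := mul_le_mul_of_nonneg_left hst hβ0.le
  have h7 : 0 ≤ β * (dnrm (M k - g) * (2 * η)) := by positivity
  nlinarith
end

section
/- Let α^k := (k+1)^{−2/3} and β^k := 1 − (k+1)^{−2/3} for k ∈ ℕ, and write β^{a:b} := ∏_{k=a}^{b} β^k, with the convention β^{a:b} = 1 when a > b. Then for all integers K ≥ 1: Σ_{k=0}^{K−1} (k+1)^{−2/3} · √( Σ_{τ=0}^{k} (β^{(τ+1):k} α^τ)² ) ≤ 12 + √(2e³)·log K, where log denotes the natural logarithm. -/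
theorem step_bound (α β : ℕ → ℝ)
    (hα : ∀ k, α k = ((k : ℝ) + 1) ^ (-(2 / 3) : ℝ))
    (hβ : ∀ k, β k = 1 - ((k : ℝ) + 1) ^ (-(2 / 3) : ℝ)) (k : ℕ) :
    ∑ τ ∈ Finset.range (k + 1), ((∏ s ∈ Finset.Icc (τ + 1) k, β s) * α τ) ^ 2 ≤ α k := by
  induction k with
  | zero => simp [hα]
  | succ k ih =>
    have hb : β (k + 1) = 1 - α (k + 1) := by rw [hα, hβ]
    have hrec : ∑ τ ∈ Finset.range (k + 1 + 1),
        ((∏ s ∈ Finset.Icc (τ + 1) (k + 1), β s) * α τ) ^ 2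
        = β (k + 1) ^ 2 * (∑ τ ∈ Finset.range (k + 1),
          ((∏ s ∈ Finset.Icc (τ + 1) k, β s) * α τ) ^ 2) + α (k + 1) ^ 2 := by
      rw [Finset.sum_range_succ, Finset.mul_sum]
      congr 1
      · refine Finset.sum_congr rfl fun τ hτ => ?_
        have : τ < k + 1 := Finset.mem_range.mp hτ
        rw [Finset.prod_Icc_succ_top (by omega)]
        ring
      · simp
    rw [hrec, hb]
    have hn : (0 : ℝ) < (k : ℝ) + 1 := by positivity
    have hm : (0 : ℝ) < (k : ℝ) + 1 + 1 := by positivity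
    have ha0 : 0 < α (k + 1) := by rw [hα]; positivity
    have ha1 : α (k + 1) ≤ 1 := by
      rw [hα]
      exact Real.rpow_le_one_of_one_le_of_nonpos (by push_cast; linarith) (by norm_num)
    have ha : 1 ≤ α (k + 1) * ((k : ℝ) + 1 + 1) := by
      rw [hα]; push_cast
      nth_rewrite 2 [← Real.rpow_one ((k : ℝ) + 1 + 1)]
      rw [← Real.rpow_add hm]
      exact Real.one_le_rpow (by linarith) (by norm_num)
    have hab : α k * ((k : ℝ) + 1) ≤ α (k + 1) * ((k : ℝ) + 1 + 1) := by
      rw [hα, hα]; push_cast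
      nth_rewrite 2 [← Real.rpow_one ((k : ℝ) + 1)]
      nth_rewrite 2 [← Real.rpow_one ((k : ℝ) + 1 + 1)]
      rw [← Real.rpow_add hm, ← Real.rpow_add hn]
      exact Real.rpow_le_rpow hn.le (by linarith) (by norm_num)
    generalize α (k + 1) = a at *
    generalize α k = b at *
    generalize (k : ℝ) + 1 = n at *
    have h1 : (1 - a) ^ 2 * b * n ≤ (a - a ^ 2) * n := by
      have e1 : (1 - a) ^ 2 * (b * n) ≤ (1 - a) ^ 2 * (a * (n + 1)) :=
        mul_le_mul_of_nonneg_left hab (sq_nonneg _)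
      have e2 : 0 ≤ (a * (1 - a)) * (a * (n + 1) - 1) :=
        mul_nonneg (mul_nonneg ha0.le (by linarith)) (by linarith)
      nlinarith
    have h2 := le_of_mul_le_mul_right h1 hn
    have h3 := mul_le_mul_of_nonneg_left ih (sq_nonneg (1 - a))
    linarith

/-- **Lemma 1 (decreasing step sizes)**: with `α^k = (k+1)^{-2/3}`,
`β^k = 1 − (k+1)^{-2/3}` and `β^{a:b} = ∏_{k=a}^b β^k`, for all `K ≥ 1`,
`∑_{k=0}^{K−1} (k+1)^{-2/3} √(∑_{τ=0}^k (β^{(τ+1):k} α^τ)²) ≤ 12 + √(2e³) log K`. -/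
theorem decreasing_step_lemma_one
    (α β : ℕ → ℝ)
    (hα : ∀ k, α k = ((k : ℝ) + 1) ^ (-(2 / 3) : ℝ))
    (hβ : ∀ k, β k = 1 - ((k : ℝ) + 1) ^ (-(2 / 3) : ℝ))
    (K : ℕ) (hK : 1 ≤ K) :
    ∑ k ∈ Finset.range K, ((k : ℝ) + 1) ^ (-(2 / 3) : ℝ) *
        Real.sqrt (∑ τ ∈ Finset.range (k + 1),
          ((∏ s ∈ Finset.Icc (τ + 1) k, β s) * α τ) ^ 2)
      ≤ 12 + Real.sqrt (2 * Real.exp 1 ^ 3) * Real.log K := by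
  have hSk := step_bound α β hα hβ
  have h1 : ∑ k ∈ Finset.range K, ((k : ℝ) + 1) ^ (-(2 / 3) : ℝ) *
        Real.sqrt (∑ τ ∈ Finset.range (k + 1),
          ((∏ s ∈ Finset.Icc (τ + 1) k, β s) * α τ) ^ 2)
      ≤ ∑ k ∈ Finset.range K, ((k : ℝ) + 1)⁻¹ := by
    refine Finset.sum_le_sum fun k _ => ?_
    have hp : (0 : ℝ) < (k : ℝ) + 1 := by positivity
    have h2 := Real.sqrt_le_sqrt (hSk k)
    rw [hα k, Real.sqrt_eq_rpow (((k : ℝ) + 1) ^ (-(2 / 3) : ℝ)), ← Real.rpow_mul hp.le] at h2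
    calc _ ≤ ((k : ℝ) + 1) ^ (-(2 / 3) : ℝ) * ((k : ℝ) + 1) ^ (-(2 / 3) * (1 / 2) : ℝ) :=
          mul_le_mul_of_nonneg_left h2 (by positivity)
      _ = ((k : ℝ) + 1)⁻¹ := by
          rw [← Real.rpow_add hp, ← Real.rpow_neg_one]; norm_num
  have h3 := harmonic_le_one_add_log K
  have h4 : ((harmonic K : ℚ) : ℝ) = ∑ k ∈ Finset.range K, ((k : ℝ) + 1)⁻¹ := by
    simp [harmonic]
  rw [h4] at h3
  have h5 : 0 ≤ Real.log K := Real.log_natCast_nonneg K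
  have h6 : 1 ≤ Real.sqrt (2 * Real.exp 1 ^ 3) := by
    rw [Real.one_le_sqrt]
    have : 1 ≤ Real.exp 1 ^ 3 := one_le_pow₀ (Real.one_le_exp (by norm_num))
    linarith
  nlinarith
end

section
/- Fix t > 0 and let t^k := t·(k+1)^{−2/3} and β^k := 1 − (k+1)^{−2/3} for k ∈ ℕ, and write β^{a:b} := ∏_{k=a}^{b} β^k, with the convention β^{a:b} = 1 when a > b. Then for all integers K ≥ 1: Σ_{k=0}^{K−1} (k+1)^{−2/3} · √( Σ_{τ=1}^{k} (β^{(τ+1):k} t^τ)² ) ≤ t·(12 + √(2e³)·log K), where log denotes the natural logarithm. -/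
theorem aux_key (x : ℝ) (hx : 0 < x) :
    (1 - (x + 1) ^ (-(2 / 3) : ℝ)) * x ^ (-(2 / 3) : ℝ) ≤ (x + 1) ^ (-(2 / 3) : ℝ) := by
  have h := Real.rpow_add_le_add_rpow hx.le (zero_le_one' ℝ) (p := (2 / 3 : ℝ))
    (by norm_num) (by norm_num)
  rw [Real.one_rpow] at h
  rw [Real.rpow_neg hx.le, Real.rpow_neg (by linarith)]
  have hb : 0 < (x + 1) ^ (2 / 3 : ℝ) := Real.rpow_pos_of_pos (by linarith) _
  have hc : 0 < x ^ (2 / 3 : ℝ) := Real.rpow_pos_of_pos hx _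
  generalize (x + 1) ^ (2 / 3 : ℝ) = b at *
  generalize x ^ (2 / 3 : ℝ) = c at *
  rw [← div_eq_mul_inv, div_le_iff₀ hc]
  have : 1 - b⁻¹ = b⁻¹ * (b - 1) := by field_simp
  rw [this]
  exact mul_le_mul_of_nonneg_left (by linarith) (inv_nonneg.2 hb.le)

theorem aux_S (t : ℝ) (tk β : ℕ → ℝ)
    (htk : ∀ k, tk k = t * ((k : ℝ) + 1) ^ (-(2 / 3) : ℝ))
    (hβ : ∀ k, β k = 1 - ((k : ℝ) + 1) ^ (-(2 / 3) : ℝ)) (k : ℕ) :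
    ∑ τ ∈ Finset.Icc 1 k, ((∏ s ∈ Finset.Icc (τ + 1) k, β s) * tk τ) ^ 2
      ≤ t ^ 2 * ((k : ℝ) + 1) ^ (-(2 / 3) : ℝ) := by
  induction k with
  | zero => simp; positivity
  | succ k ih =>
    rw [Finset.sum_Icc_succ_top (by omega)]
    have e : ∑ τ ∈ Finset.Icc 1 k, ((∏ s ∈ Finset.Icc (τ + 1) (k + 1), β s) * tk τ) ^ 2
        = β (k + 1) ^ 2 *
          ∑ τ ∈ Finset.Icc 1 k, ((∏ s ∈ Finset.Icc (τ + 1) k, β s) * tk τ) ^ 2 := by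
      rw [Finset.mul_sum]
      refine Finset.sum_congr rfl fun τ hτ => ?_
      rw [Finset.mem_Icc] at hτ
      rw [Finset.prod_Icc_succ_top (by omega)]
      ring
    rw [e, Finset.Icc_eq_empty (by omega : ¬ (k + 1 + 1 ≤ k + 1)), Finset.prod_empty, hβ, htk]
    have key := aux_key ((k : ℝ) + 1) (by positivity)
    push_cast
    have ha1 : ((k : ℝ) + 1 + 1) ^ (-(2 / 3) : ℝ) ≤ 1 :=
      Real.rpow_le_one_of_one_le_of_nonpos (by linarith [(Nat.cast_nonneg k : (0 : ℝ) ≤ k)])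
        (by norm_num)
    generalize ((k : ℝ) + 1 + 1) ^ (-(2 / 3) : ℝ) = a at *
    generalize ((k : ℝ) + 1) ^ (-(2 / 3) : ℝ) = a' at *
    have h1 := mul_le_mul_of_nonneg_left ih (sq_nonneg (1 - a))
    have h2 := mul_le_mul_of_nonneg_left key
      (mul_nonneg (sq_nonneg t) (sub_nonneg.2 ha1))
    nlinarith [h1, h2]


/-- **Lemma 2 (decreasing step sizes)**: with `t^k = t(k+1)^{-2/3}` for fixed `t > 0`,
`β^k = 1 − (k+1)^{-2/3}` and `β^{a:b} = ∏_{k=a}^b β^k`, for all `K ≥ 1`,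
`∑_{k=0}^{K−1} (k+1)^{-2/3} √(∑_{τ=1}^k (β^{(τ+1):k} t^τ)²) ≤ t(12 + √(2e³) log K)`. -/
theorem decreasing_step_lemma_two
    (t : ℝ) (ht : 0 < t)
    (tk β : ℕ → ℝ)
    (htk : ∀ k, tk k = t * ((k : ℝ) + 1) ^ (-(2 / 3) : ℝ))
    (hβ : ∀ k, β k = 1 - ((k : ℝ) + 1) ^ (-(2 / 3) : ℝ))
    (K : ℕ) (hK : 1 ≤ K) :
    ∑ k ∈ Finset.range K, ((k : ℝ) + 1) ^ (-(2 / 3) : ℝ) *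
        Real.sqrt (∑ τ ∈ Finset.Icc 1 k,
          ((∏ s ∈ Finset.Icc (τ + 1) k, β s) * tk τ) ^ 2)
      ≤ t * (12 + Real.sqrt (2 * Real.exp 1 ^ 3) * Real.log K) := by
  have hterm : ∀ k ∈ Finset.range K, ((k : ℝ) + 1) ^ (-(2 / 3) : ℝ) *
        Real.sqrt (∑ τ ∈ Finset.Icc 1 k,
          ((∏ s ∈ Finset.Icc (τ + 1) k, β s) * tk τ) ^ 2) ≤ t * ((k : ℝ) + 1)⁻¹ := by
    intro k _
    have hx : (0 : ℝ) < (k : ℝ) + 1 := by positivity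
    have h1 : Real.sqrt (∑ τ ∈ Finset.Icc 1 k,
          ((∏ s ∈ Finset.Icc (τ + 1) k, β s) * tk τ) ^ 2)
          ≤ t * ((k : ℝ) + 1) ^ (-(1 / 3) : ℝ) := by
      apply Real.sqrt_le_iff.2 ⟨by positivity, (aux_S t tk β htk hβ k).trans (le_of_eq ?_)⟩
      rw [mul_pow, ← Real.rpow_mul_natCast hx.le]
      norm_num
    refine (mul_le_mul_of_nonneg_left h1 (by positivity)).trans (le_of_eq ?_)
    rw [mul_left_comm, ← Real.rpow_add hx, ← Real.rpow_neg_one]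
    norm_num
  refine (Finset.sum_le_sum hterm).trans ?_
  rw [← Finset.mul_sum]
  refine mul_le_mul_of_nonneg_left ?_ ht.le
  have hh := harmonic_le_one_add_log K
  simp only [harmonic] at hh
  push_cast at hh
  have hlog : 0 ≤ Real.log K := Real.log_nonneg (by exact_mod_cast hK)
  have hs : 1 ≤ Real.sqrt (2 * Real.exp 1 ^ 3) := by
    rw [Real.one_le_sqrt]
    have : 1 ≤ Real.exp 1 ^ 3 := one_le_pow₀ (Real.one_le_exp (by norm_num))
    linarith
  nlinarith [mul_le_mul_of_nonneg_right hs hlog]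
end

section
/- Let β ∈ (0,1), α := 1−β, q ∈ (0,1], and v := (1−q)/(1−α) = (1−q)/β. Then for every integer k ≥ 0: Σ_{j=1}^{k} α²β^{2k−2j} + 2·Σ_{1 ≤ j < s ≤ k} α²β^{2k−2j}v^{s−j} ≤ 2α/((2−α)(α+βq)). -/
theorem aux_closed (β v : ℝ) (k : ℕ) :
    (∑ i ∈ Finset.range k, β ^ (2 * i) * (1 + 2 * ∑ t ∈ Finset.range i, v ^ (t + 1)))
      * ((1 - β ^ 2) * (1 - β ^ 2 * v))
    = (1 + β ^ 2 * v) - β ^ (2 * k) * ((1 + 2 * ∑ t ∈ Finset.range k, v ^ (t + 1))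
      * (1 - β ^ 2 * v) + 2 * v ^ (k + 1) * β ^ 2) := by
  induction k with
  | zero => simp; ring
  | succ n ih =>
    rw [Finset.sum_range_succ, add_mul, ih, Finset.sum_range_succ]
    ring

theorem aux_reindex (α β v : ℝ) (k : ℕ) :
    (∑ j ∈ Finset.Icc 1 k, α ^ 2 * β ^ (2 * k - 2 * j))
      + 2 * ∑ j ∈ Finset.Icc 1 k, ∑ s ∈ Finset.Icc (j + 1) k,
          α ^ 2 * β ^ (2 * k - 2 * j) * v ^ (s - j)
    = α ^ 2 * ∑ i ∈ Finset.range k,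
        β ^ (2 * i) * (1 + 2 * ∑ t ∈ Finset.range i, v ^ (t + 1)) := by
  rw [Finset.mul_sum, Finset.mul_sum, ← Finset.sum_add_distrib]
  refine Finset.sum_nbij' (fun j => k - j) (fun i => k - i) ?_ ?_ ?_ ?_ ?_
  · intro j hj; simp only [Finset.mem_Icc, Finset.mem_range] at *; omega
  · intro j hj; simp only [Finset.mem_Icc, Finset.mem_range] at *; omega
  · intro j hj; simp only [Finset.mem_Icc] at *; omega
  · intro j hj; simp only [Finset.mem_range] at *; omega
  · intro j hj
    simp only [Finset.mem_Icc] at hj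
    have h : ∑ s ∈ Finset.Icc (j + 1) k, v ^ (s - j)
        = ∑ t ∈ Finset.range (k - j), v ^ (t + 1) := by
      refine Finset.sum_nbij' (fun s => s - j - 1) (fun t => j + 1 + t) ?_ ?_ ?_ ?_ ?_
      · intro s hs; simp only [Finset.mem_Icc, Finset.mem_range] at *; omega
      · intro s hs; simp only [Finset.mem_Icc, Finset.mem_range] at *; omega
      · intro s hs; simp only [Finset.mem_Icc] at *; omega
      · intro s hs; simp only [Finset.mem_range] at *; omega
      · intro s hs
        simp only [Finset.mem_Icc] at hs
        congr 1; omega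
    rw [← Finset.mul_sum, h, ← Nat.mul_sub]
    ring

/-- **Lemma (geometric double-sum bound for Gluon-MVR-2)**: for `β ∈ (0,1)`, `α = 1−β`,
`q ∈ (0,1]`, `v = (1−q)/(1−α)`, and every `k ≥ 0`,
`∑_{j=1}^k α²β^{2k−2j} + 2∑_{1≤j<s≤k} α²β^{2k−2j} v^{s−j} ≤ 2α/((2−α)(α+βq))`. -/
theorem gluon_mvr2_double_sum_bound
    (β q α v : ℝ)
    (hβ : β ∈ Set.Ioo (0 : ℝ) 1)
    (hq : q ∈ Set.Ioc (0 : ℝ) 1)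
    (hα : α = 1 - β)
    (hv : v = (1 - q) / (1 - α))
    (k : ℕ) :
    (∑ j ∈ Finset.Icc 1 k, α ^ 2 * β ^ (2 * k - 2 * j))
      + 2 * ∑ j ∈ Finset.Icc 1 k, ∑ s ∈ Finset.Icc (j + 1) k,
          α ^ 2 * β ^ (2 * k - 2 * j) * v ^ (s - j)
    ≤ 2 * α / ((2 - α) * (α + β * q)) := by
  obtain ⟨hb0, hb1⟩ := hβ
  obtain ⟨hq0, hq1⟩ := hq
  rw [aux_reindex]
  have hc := aux_closed β v k
  have hv0 : 0 ≤ v := by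
    rw [hv]; apply div_nonneg <;> linarith
  have hbv : β * v = 1 - q := by
    rw [hv, hα]
    have : (1 - (1 - β)) = β := by ring
    rw [this]; field_simp
  have hb2v : β ^ 2 * v = β * (1 - q) := by rw [← hbv]; ring
  have hP : 0 ≤ ∑ t ∈ Finset.range k, v ^ (t + 1) :=
    Finset.sum_nonneg fun t _ => pow_nonneg hv0 _
  have hw : β * (1 - q) < 1 := by nlinarith
  rw [hb2v] at hc
  have hR : 0 ≤ β ^ (2 * k) * ((1 + 2 * ∑ t ∈ Finset.range k, v ^ (t + 1))
      * (1 - β * (1 - q)) + 2 * v ^ (k + 1) * β ^ 2) := by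
    have : 0 ≤ 1 - β * (1 - q) := by linarith
    positivity
  set S := ∑ i ∈ Finset.range k, β ^ (2 * i) * (1 + 2 * ∑ t ∈ Finset.range i, v ^ (t + 1))
  have hS : S * ((1 - β ^ 2) * (1 - β * (1 - q))) ≤ 2 := by linarith
  subst hα
  have h1 : 0 < 1 - β := by linarith
  have h2 : 0 < 1 - β + β * q := by nlinarith
  rw [le_div_iff₀ (mul_pos (by linarith) h2)]
  have := mul_le_mul_of_nonneg_left hS h1.le
  linarith [this]
end
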